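/- Let F be a free filter on ω. The following are equivalent: (1) F does not have the Nikodym property; (2) there is a density submeasure φ on ω such that φ(ℕ) = ∞ and F ⊆ Exh(φ)*; (3) there is a non-pathological lower semicontinuous submeasure φ on ω such that φ(ℕ) = ∞ and F ⊆ Exh(φ)*. -/

import Mathlib

open Filter Topology Set MeasureTheory
open scoped ENNReal NNReal

noncomputable section

/-- The space `N_F = ℕ ∪ {p_F}`, modelled as `Option ℕ` with `none` playing the role of `p_F`:
every natural number (i.e. `some n`) is isolated, and a set containing `none` is open iff its
trace on `ℕ` belongs to `F`. -/
def NFTop (F : Filter ℕ) : TopologicalSpace (Option ℕ) where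
  IsOpen U := none ∈ U → {n : ℕ | some n ∈ U} ∈ F
  isOpen_univ := fun _ => Filter.univ_mem
  isOpen_inter := fun U V hU hV h => Filter.inter_mem (hU h.1) (hV h.2)
  isOpen_sUnion := fun S hS h => by
    obtain ⟨U, hUS, hU⟩ := h
    exact Filter.mem_of_superset (hS U hUS hU) fun n hn => ⟨U, hUS, hn⟩

/-- A finitely supported signed measure on `N_F` is modelled as a finitely supported
function `Option ℕ →₀ ℝ`; its value on a set `A` is the sum of its weights on `A`. -/
def fsMeas (μ : Option ℕ →₀ ℝ) (A : Set (Option ℕ)) : ℝ :=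
  ∑ x ∈ μ.support, A.indicator (fun y => μ y) x

/-- The norm `‖μ‖ = Σ |α_i|` of a finitely supported signed measure. -/
def fsNorm (μ : Option ℕ →₀ ℝ) : ℝ :=
  ∑ x ∈ μ.support, |μ x|

/-- `‖μ ↾ B‖`, the variation of `μ` on a set `B`. -/
def fsRestrNorm (μ : Option ℕ →₀ ℝ) (B : Set (Option ℕ)) : ℝ :=
  ∑ x ∈ μ.support, B.indicator (fun y => |μ y|) x

/-- The integral `∫ f dμ` of a function against a finitely supported signed measure. -/
def fsInteg (μ : Option ℕ →₀ ℝ) (f : Option ℕ → ℝ) : ℝ :=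
  ∑ x ∈ μ.support, μ x * f x

/-- An anti-Nikodym sequence on `N_F`: `‖μ_n‖ → ∞` and `μ_n(A) → 0` for every clopen `A`. -/
def IsANSeq (F : Filter ℕ) (μ : ℕ → (Option ℕ →₀ ℝ)) : Prop :=
  Tendsto (fun n => fsNorm (μ n)) atTop atTop ∧
    ∀ A : Set (Option ℕ), @IsClopen _ (NFTop F) A →
      Tendsto (fun n => fsMeas (μ n) A) atTop (nhds 0)

/-- A free filter `F` has the Nikodym property if there is no anti-Nikodym sequence on `N_F`. -/
def HasNikodymProp (F : Filter ℕ) : Prop :=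
  ¬ ∃ μ : ℕ → (Option ℕ →₀ ℝ), IsANSeq F μ

/-- A finitely supported (nonnegative) measure on `ℕ`, evaluated on a set `A ⊆ ℕ`. -/
def natMeas (μ : ℕ →₀ ℝ) (A : Set ℕ) : ℝ :=
  ∑ x ∈ μ.support, A.indicator (fun y => μ y) x

/-- The norm of a finitely supported measure on `ℕ`. -/
def natNorm (μ : ℕ →₀ ℝ) : ℝ :=
  ∑ x ∈ μ.support, |μ x|

/-- `at⁺(μ)`: the largest atom of a finitely supported measure on `ℕ`. -/
def atPlus (μ : ℕ →₀ ℝ) : ℝ := sSup ((fun x => μ x) '' ↑μ.support)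

/-- `at⁻(μ)`: the smallest atom of a finitely supported measure on `ℕ`. -/
def atMinus (μ : ℕ →₀ ℝ) : ℝ := sInf ((fun x => μ x) '' ↑μ.support)

/-- A submeasure on `ω`. -/
structure Submeasure where
  toFun : Set ℕ → ℝ≥0∞
  empty' : toFun ∅ = 0
  finite_singleton' : ∀ n : ℕ, toFun {n} ≠ ⊤
  mono' : ∀ ⦃A B : Set ℕ⦄, A ⊆ B → toFun A ≤ toFun B
  subadd' : ∀ A B : Set ℕ, toFun (A ∪ B) ≤ toFun A + toFun B

/-- Lower semicontinuity of a submeasure: `φ(A) = lim_n φ(A ∩ [0,n])`. -/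
def Submeasure.LSC (φ : Submeasure) : Prop :=
  ∀ A : Set ℕ, Tendsto (fun n : ℕ => φ.toFun (A ∩ Set.Iic n)) atTop (nhds (φ.toFun A))

/-- The exhaustive ideal `Exh(φ) = {A : lim_n φ(A ∖ [0,n]) = 0}` of a submeasure. -/
def Exh (φ : Submeasure) : Set (Set ℕ) :=
  {A : Set ℕ | Tendsto (fun n : ℕ => φ.toFun (A \ Set.Iic n)) atTop (nhds 0)}

/-- A density submeasure: `φ = sup_n μ_n` for a sequence of finitely supported nonnegative
measures on `ℕ` with pairwise disjoint supports. -/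
def Submeasure.IsDensity (φ : Submeasure) : Prop :=
  ∃ μ : ℕ → (ℕ →₀ ℝ), (∀ n x, 0 ≤ μ n x) ∧
    (∀ m n, m ≠ n → Disjoint (μ m).support (μ n).support) ∧
    ∀ A : Set ℕ, φ.toFun A = ⨆ n : ℕ, ENNReal.ofReal (natMeas (μ n) A)

/-- A non-pathological submeasure: `φ(A)` is the supremum of `μ(A)` over all nonnegative
(σ-additive) measures `μ` on `ℕ` dominated by `φ`. -/
def Submeasure.Nonpathological (φ : Submeasure) : Prop :=
  ∀ A : Set ℕ,
    φ.toFun A =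
      ⨆ (w : ℕ → ℝ≥0∞) (_ : ∀ B : Set ℕ, ∑' n : B, w n ≤ φ.toFun B), ∑' n : A, w n

/-- An ideal on `ω`: contains all finite sets, closed under subsets and finite unions,
and does not contain `ℕ` itself. -/
def IsIdeal (I : Set (Set ℕ)) : Prop :=
  (∀ A : Set ℕ, A.Finite → A ∈ I) ∧
    (∀ A B : Set ℕ, A ⊆ B → B ∈ I → A ∈ I) ∧
    (∀ A B : Set ℕ, A ∈ I → B ∈ I → A ∪ B ∈ I) ∧
    Set.univ ∉ I

/-- The Katětov order on families of subsets of `ℕ`. -/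
def KatLE (I J : Set (Set ℕ)) : Prop :=
  ∃ f : ℕ → ℕ, ∀ A ∈ I, f ⁻¹' A ∈ J

/-- The dual filter `I*` of an ideal `I` (as a `Filter`; when `I` is an ideal, this filter's
sets are exactly the complements of members of `I`). -/
def dualFilter (I : Set (Set ℕ)) : Filter ℕ :=
  Filter.generate {A : Set ℕ | Aᶜ ∈ I}

/-- The class `AN` of all ideals on `ω` whose dual filters do not have the Nikodym property. -/
def ANclass : Set (Set (Set ℕ)) :=
  {I | IsIdeal I ∧ ¬ HasNikodymProp (dualFilter I)}

/-- A density ideal: `Exh(sup_n μ_n)` for a disjointly supported sequence of finitely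
supported nonnegative measures on `ℕ`. -/
def IsDensityIdeal (I : Set (Set ℕ)) : Prop :=
  ∃ μ : ℕ → (ℕ →₀ ℝ), (∀ n x, 0 ≤ μ n x) ∧
    (∀ m n, m ≠ n → Disjoint (μ m).support (μ n).support) ∧
    I = {A : Set ℕ |
      Tendsto (fun m : ℕ => ⨆ n : ℕ, ENNReal.ofReal (natMeas (μ n) (A \ Set.Iic m)))
        atTop (nhds 0)}

/-- The asymptotic density submeasure `φ_d(A) = sup_n |A ∩ [2^n, 2^{n+1})|/2^n`. -/
def phid (A : Set ℕ) : ℝ≥0∞ :=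
  ⨆ n : ℕ, ((A ∩ Set.Ico (2 ^ n) (2 ^ (n + 1))).ncard : ℝ≥0∞) / 2 ^ n

/-- The asymptotic density zero ideal `Z = Exh(φ_d)`. -/
def Zideal : Set (Set ℕ) :=
  {A : Set ℕ | Tendsto (fun m : ℕ => phid (A \ Set.Iic m)) atTop (nhds 0)}

/-- `Exh(sup_{n ≥ 1} ν_n)` for a sequence of finitely supported measures indexed by `n ≥ 1`. -/
def ExhSupPos (ν : ℕ → (ℕ →₀ ℝ)) : Set (Set ℕ) :=
  {A : Set ℕ |
    Tendsto (fun m : ℕ => ⨆ n : ℕ, ENNReal.ofReal (natMeas (ν (n + 1)) (A \ Set.Iic m)))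
      atTop (nhds 0)}

/-- `PhiStart f n` is the left endpoint of the interval `I_n` in the interval partition
associated with `f` (so `I_n = [PhiStart f n, PhiStart f (n+1))` has `n·f(n)` elements). -/
def PhiStart (f : ℕ → ℕ) (n : ℕ) : ℕ :=
  ∑ k ∈ Finset.range n, k * f k

/-- The density ideal `Φ(f) = Exh(sup_{n≥1} μ_n^f)`, where `μ_n^f` gives mass `1/f(n)` to each
point of the interval `I_n` (of size `n·f(n)`), so that `‖μ_n^f‖ = n`. -/
def PhiIdeal (f : ℕ → ℕ) : Set (Set ℕ) :=
  {A : Set ℕ |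
    Tendsto (fun m : ℕ => ⨆ n : ℕ,
        ENNReal.ofReal
          (((A \ Set.Iic m) ∩ Set.Ico (PhiStart f (n + 1)) (PhiStart f (n + 2))).ncard
            / f (n + 1)))
      atTop (nhds 0)}

/-- The dominating number `𝔡`. -/
def domNumber : Cardinal :=
  sInf {c : Cardinal | ∃ D : Set (ℕ → ℕ), Cardinal.mk D = c ∧
    ∀ g : ℕ → ℕ, ∃ f ∈ D, ∀ᶠ n in atTop, g n ≤ f n}

/-- The unbounding number `𝔟`. -/
def unbNumber : Cardinal :=
  sInf {c : Cardinal | ∃ U : Set (ℕ → ℕ), Cardinal.mk U = c ∧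
    ∀ g : ℕ → ℕ, ∃ f ∈ U, {n : ℕ | g n < f n}.Infinite}

/-- A P-ideal: every countable family in `J` has a pseudo-union in `J`. -/
def IsPIdeal (J : Set (Set ℕ)) : Prop :=
  ∀ A : ℕ → Set ℕ, (∀ n, A n ∈ J) → ∃ B ∈ J, ∀ n, (A n \ B).Finite

/-- The characteristic-function embedding of `P(ℕ)` into the Cantor space `2^ℕ`. -/
def chi (A : Set ℕ) : ℕ → Bool :=
  fun n => @decide (n ∈ A) (Classical.propDecidable _)

end
theorem natMeas_eq_sum {u : ℕ →₀ ℝ} {s : Finset ℕ} (h : ∀ x ∉ s, u x = 0) (A : Set ℕ) :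
    natMeas u A = ∑ x ∈ s, A.indicator u x := by
  refine Finset.sum_subset (fun x hx => ?_) (fun x _ hx => ?_)
  · by_contra hs
    exact Finsupp.mem_support_iff.1 hx (h x hs)
  · have : u x = 0 := by simpa using hx
    simp [this]

theorem natMeas_nonneg {u : ℕ →₀ ℝ} (hu : ∀ x, 0 ≤ u x) (A : Set ℕ) : 0 ≤ natMeas u A :=
  Finset.sum_nonneg fun _ _ => Set.indicator_nonneg (fun y _ => hu y) _

theorem natMeas_mono {u : ℕ →₀ ℝ} (hu : ∀ x, 0 ≤ u x) {A B : Set ℕ} (h : A ⊆ B) :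
    natMeas u A ≤ natMeas u B :=
  Finset.sum_le_sum fun _ _ => Set.indicator_le_indicator_of_subset h hu _

theorem natMeas_union_le {u : ℕ →₀ ℝ} (hu : ∀ x, 0 ≤ u x) (A B : Set ℕ) :
    natMeas u (A ∪ B) ≤ natMeas u A + natMeas u B := by
  unfold natMeas
  rw [← Finset.sum_add_distrib]
  refine Finset.sum_le_sum fun x _ => ?_
  have := hu x
  by_cases hA : x ∈ A <;> by_cases hB : x ∈ B <;> simp [hA, hB, this]

theorem natMeas_add_compl (u : ℕ →₀ ℝ) (A : Set ℕ) :
    natMeas u A + natMeas u Aᶜ = natMeas u Set.univ := by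
  unfold natMeas
  rw [← Finset.sum_add_distrib]
  refine Finset.sum_congr rfl fun x _ => ?_
  by_cases hA : x ∈ A <;> simp [hA]

theorem tsum_ofReal_eq_natMeas {u : ℕ →₀ ℝ} (hu : ∀ x, 0 ≤ u x) (A : Set ℕ) :
    ∑' x : A, ENNReal.ofReal (u x) = ENNReal.ofReal (natMeas u A) := by
  rw [tsum_subtype A (fun x => ENNReal.ofReal (u x)), tsum_eq_sum (s := u.support), natMeas,
    ENNReal.ofReal_sum_of_nonneg fun _ _ => Set.indicator_nonneg (fun y _ => hu y) _]
  · refine Finset.sum_congr rfl fun x _ => ?_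
    by_cases hA : x ∈ A <;> simp [hA]
  · intro x hx
    have : u x = 0 := by simpa using hx
    simp [this]

theorem fsMeas_eq_sum {μ : Option ℕ →₀ ℝ} {s : Finset ℕ} (h : ∀ x ∉ s, μ (some x) = 0)
    (A : Set (Option ℕ)) :
    fsMeas μ A = A.indicator μ none + ∑ x ∈ s, A.indicator μ (some x) := by
  rw [fsMeas, ← Finset.sum_insertNone]
  refine Finset.sum_subset (fun x hx => ?_) (fun x _ hx => ?_)
  · cases x with
    | none => simp
    | some x =>
      rw [Finset.some_mem_insertNone]
      by_contra hs
      exact Finsupp.mem_support_iff.1 hx (h x hs)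
  · have : μ x = 0 := by simpa using hx
    simp [this]

theorem fsNorm_eq_sum {μ : Option ℕ →₀ ℝ} {s : Finset ℕ} (h : ∀ x ∉ s, μ (some x) = 0) :
    fsNorm μ = |μ none| + ∑ x ∈ s, |μ (some x)| := by
  rw [fsNorm, ← Finset.sum_insertNone (fun x => |μ x|)]
  refine Finset.sum_subset (fun x hx => ?_) (fun x _ hx => ?_)
  · cases x with
    | none => simp
    | some x =>
      rw [Finset.some_mem_insertNone]
      by_contra hs
      exact Finsupp.mem_support_iff.1 hx (h x hs)
  · have : μ x = 0 := by simpa using hx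
    simp [this]

theorem isClopen_NFTop_iff {F : Filter ℕ} {A : Set (Option ℕ)} :
    @IsClopen _ (NFTop F) A ↔
      (none ∈ A → {n : ℕ | some n ∈ A} ∈ F) ∧ (none ∉ A → {n : ℕ | some n ∈ A}ᶜ ∈ F) := by
  let := NFTop F
  rw [IsClopen, ← isOpen_compl_iff]
  exact and_comm

theorem isClopen_image_some {F : Filter ℕ} {A : Set ℕ} (hA : Aᶜ ∈ F) :
    @IsClopen _ (NFTop F) (some '' A) := by
  rw [isClopen_NFTop_iff]
  refine ⟨by simp, fun _ => ?_⟩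
  simpa using hA

theorem Submeasure.IsDensity.lsc {φ : Submeasure} (h : φ.IsDensity) : φ.LSC := by
  obtain ⟨μ, hpos, -, hφ⟩ := h
  intro A
  have hmono : Monotone fun n : ℕ => φ.toFun (A ∩ Set.Iic n) := fun m n hmn =>
    φ.mono' (Set.inter_subset_inter_right _ (Set.Iic_subset_Iic.2 hmn))
  have hsup : φ.toFun A = ⨆ n : ℕ, φ.toFun (A ∩ Set.Iic n) := by
    refine le_antisymm ?_ (iSup_le fun n => φ.mono' Set.inter_subset_left)
    rw [hφ A]
    refine iSup_le fun k => ?_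
    obtain ⟨n, hn⟩ := (μ k).support.exists_nat_subset_range
    refine le_iSup_of_le n ?_
    rw [hφ]
    refine le_iSup_of_le k (ENNReal.ofReal_le_ofReal (Finset.sum_le_sum fun x hx => ?_))
    have hxn : x ≤ n := (Finset.mem_range.1 (hn hx)).le
    by_cases hA : x ∈ A <;> simp [hA, hxn]
  rw [hsup]
  exact tendsto_atTop_iSup hmono

theorem Submeasure.IsDensity.nonpathological {φ : Submeasure} (h : φ.IsDensity) :
    φ.Nonpathological := by
  obtain ⟨μ, hpos, -, hφ⟩ := h
  intro A
  refine le_antisymm ?_ (iSup₂_le fun w hw => hw A)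
  rw [hφ A]
  refine iSup_le fun k => ?_
  rw [← tsum_ofReal_eq_natMeas (hpos k)]
  refine le_iSup₂_of_le (fun x => ENNReal.ofReal (μ k x)) (fun B => ?_) le_rfl
  rw [tsum_ofReal_eq_natMeas (hpos k), hφ B]
  exact le_iSup (fun n => ENNReal.ofReal (natMeas (μ n) B)) k

theorem Submeasure.Iic_ne_top (φ : Submeasure) (k : ℕ) : φ.toFun (Set.Iic k) ≠ ⊤ := by
  induction k with
  | zero =>
    have : Set.Iic (0 : ℕ) = {0} := by ext; simp
    exact this ▸ φ.finite_singleton' 0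
  | succ k ih =>
    have : Set.Iic (k + 1) = Set.Iic k ∪ {k + 1} := by ext; simp; omega
    rw [this]
    exact ne_top_of_le_ne_top (ENNReal.add_ne_top.2 ⟨ih, φ.finite_singleton' _⟩) (φ.subadd' _ _)

theorem Submeasure.Ioi_eq_top {φ : Submeasure} (h : φ.toFun Set.univ = ⊤) (k : ℕ) :
    φ.toFun (Set.Ioi k) = ⊤ := by
  by_contra hk
  have := φ.subadd' (Set.Iic k) (Set.Ioi k)
  rw [Set.Iic_union_Ioi, h, top_le_iff] at this
  exact ENNReal.add_ne_top.2 ⟨φ.Iic_ne_top k, hk⟩ this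

/-- A non-pathological lsc submeasure of infinite total mass dominates finitely supported
measures of arbitrarily large mass living arbitrarily far out. -/
theorem Submeasure.exists_dominated {φ : Submeasure} (hlsc : φ.LSC) (hnp : φ.Nonpathological)
    (htop : φ.toFun Set.univ = ⊤) (k : ℕ) :
    ∃ u : ℕ →₀ ℝ, (∀ x, 0 ≤ u x) ∧ (k : ℝ) ≤ natMeas u Set.univ ∧
      ∀ A : Set ℕ, ENNReal.ofReal (natMeas u A) ≤ φ.toFun (A \ Set.Iic k) := by
  have hlim := hlsc (Set.Ioi k)
  rw [φ.Ioi_eq_top htop] at hlim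
  obtain ⟨n, hn⟩ := (hlim.eventually (lt_mem_nhds (ENNReal.natCast_lt_top k))).exists
  rw [hnp, lt_iSup_iff] at hn
  obtain ⟨w, hn⟩ := hn
  obtain ⟨hw, hn⟩ := lt_iSup_iff.1 hn
  have hfin : ∀ x, w x ≠ ⊤ := fun x => by
    refine ne_top_of_le_ne_top (φ.finite_singleton' x) ?_
    simpa using hw {x}
  have hu : ∀ x, 0 ≤ (Set.Ioc k n).indicator (fun x => (w x).toReal) x := fun x =>
    Set.indicator_nonneg (fun _ _ => ENNReal.toReal_nonneg) x
  let u : ℕ →₀ ℝ := Finsupp.onFinset (Finset.Ioc k n)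
    ((Set.Ioc k n).indicator fun x => (w x).toReal) fun x hx => by
      simpa using Set.mem_of_indicator_ne_zero hx
  have hofReal : ∀ x, ENNReal.ofReal (u x) = (Set.Ioc k n).indicator w x := fun x => by
    by_cases hx : x ∈ Set.Ioc k n
    · simp only [u, Finsupp.onFinset_apply, Set.indicator_of_mem hx,
        ENNReal.ofReal_toReal (hfin x)]
    · simp only [u, Finsupp.onFinset_apply, Set.indicator_of_notMem hx, ENNReal.ofReal_zero]
  have hmeas : ∀ A : Set ℕ,
      ENNReal.ofReal (natMeas u A) = ∑' x : (A ∩ Set.Ioc k n : Set ℕ), w x := fun A => by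
    rw [← tsum_ofReal_eq_natMeas hu, tsum_subtype A fun x => ENNReal.ofReal (u x),
      tsum_subtype (A ∩ Set.Ioc k n) w, ← Set.indicator_indicator]
    simp only [hofReal]
  refine ⟨u, hu, ?_, fun A => ?_⟩
  · rw [Set.Ioi_inter_Iic, ← Set.univ_inter (Set.Ioc k n), ← hmeas] at hn
    rw [← ENNReal.ofReal_natCast] at hn
    exact (ENNReal.ofReal_lt_ofReal_iff_of_nonneg (Nat.cast_nonneg k)).1 hn |>.le
  · rw [hmeas]
    refine (hw _).trans (φ.mono' fun x hx => ⟨hx.1, ?_⟩)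
    simpa using hx.2.1

theorem exists_anSeq_of_submeasure {F : Filter ℕ} {φ : Submeasure} (hlsc : φ.LSC)
    (hnp : φ.Nonpathological) (htop : φ.toFun Set.univ = ⊤) (hF : ∀ A ∈ F, Aᶜ ∈ Exh φ) :
    ∃ μ, IsANSeq F μ := by
  choose u hu hbig hdom using Submeasure.exists_dominated hlsc hnp htop
  have hlim : ∀ A ∈ F, Tendsto (fun k => natMeas (u k) Aᶜ) atTop (nhds 0) := fun A hA => by
    have h0 : Tendsto (fun k => ENNReal.ofReal (natMeas (u k) Aᶜ)) atTop (nhds 0) :=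
      tendsto_of_tendsto_of_tendsto_of_le_of_le tendsto_const_nhds (hF A hA)
        (fun _ => zero_le) fun k => hdom k Aᶜ
    refine ((ENNReal.tendsto_toReal ENNReal.zero_ne_top).comp h0).congr fun k => ?_
    exact ENNReal.toReal_ofReal (natMeas_nonneg (hu k) _)
  let μ : ℕ → Option ℕ →₀ ℝ := fun k => (u k).optionElim (-natMeas (u k) Set.univ)
  have hsupp : ∀ k, ∀ x ∉ (u k).support, μ k (some x) = 0 := fun k x hx => by
    simpa [μ] using hx
  have hval : ∀ k A, fsMeas (μ k) A =
      A.indicator (μ k) none + natMeas (u k) {n | some n ∈ A} := fun k A => by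
    classical
    rw [fsMeas_eq_sum (hsupp k)]
    simp [natMeas, Set.indicator_apply, μ]
  refine ⟨μ, ?_, fun A hA => ?_⟩
  · refine tendsto_atTop_mono (fun k => (hbig k).trans ?_) tendsto_natCast_atTop_atTop
    rw [fsNorm_eq_sum (hsupp k)]
    refine le_add_of_le_of_nonneg ?_ (Finset.sum_nonneg fun _ _ => abs_nonneg _)
    simpa [μ] using le_abs_self _
  · rw [isClopen_NFTop_iff] at hA
    by_cases hn : none ∈ A
    · have h := (hlim _ (hA.1 hn)).neg
      rw [neg_zero] at h
      refine h.congr fun k => ?_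
      have hnone : μ k none = -natMeas (u k) Set.univ := by simp [μ]
      rw [hval, Set.indicator_of_mem hn, hnone, ← natMeas_add_compl (u k) {n | some n ∈ A}]
      ring
    · refine (hlim _ (hA.2 hn)).congr fun k => ?_
      rw [hval, Set.indicator_of_notMem hn, compl_compl, zero_add]

/-- The supremum of finitely supported nonnegative measures with disjoint supports. -/
noncomputable def densitySubmeasure (ν : ℕ → ℕ →₀ ℝ) (hpos : ∀ n x, 0 ≤ ν n x)
    (hdisj : ∀ m n, m ≠ n → Disjoint (ν m).support (ν n).support) : Submeasure where
  toFun A := ⨆ n, ENNReal.ofReal (natMeas (ν n) A)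
  empty' := by simp [natMeas]
  finite_singleton' x := by
    by_cases h : ∃ k, x ∈ (ν k).support
    · obtain ⟨k, hk⟩ := h
      refine ne_top_of_le_ne_top ENNReal.ofReal_ne_top
        (iSup_le fun n => ?_ : _ ≤ ENNReal.ofReal (natMeas (ν k) {x}))
      rcases eq_or_ne n k with rfl | hn
      · exact le_rfl
      · have hx : x ∉ (ν n).support := Finset.disjoint_right.1 (hdisj n k hn) hk
        have h0 : natMeas (ν n) {x} = 0 := Finset.sum_eq_zero fun y hy =>
          Set.indicator_of_notMem (s := {x}) (fun hyx : y = x => hx (hyx ▸ hy)) _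
        simp [h0]
    · push Not at h
      have h0 : ∀ n, natMeas (ν n) {x} = 0 := fun n => Finset.sum_eq_zero fun y hy =>
        Set.indicator_of_notMem (s := {x}) (fun hyx : y = x => h n (hyx ▸ hy)) _
      simp [h0]
  mono' A B h := iSup_mono fun n => ENNReal.ofReal_le_ofReal (natMeas_mono (hpos n) h)
  subadd' A B := iSup_le fun n => by
    refine (ENNReal.ofReal_le_ofReal (natMeas_union_le (hpos n) A B)).trans ?_
    rw [ENNReal.ofReal_add (natMeas_nonneg (hpos n) A) (natMeas_nonneg (hpos n) B)]
    exact add_le_add (le_iSup (fun n => ENNReal.ofReal (natMeas (ν n) A)) n)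
      (le_iSup (fun n => ENNReal.ofReal (natMeas (ν n) B)) n)

/-- Gliding hump: some terms of an anti-Nikodym sequence carry large mass on consecutive
disjoint intervals, and little mass before them. -/
theorem IsANSeq.exists_humps {F : Filter ℕ} (hfree : F ≤ Filter.cofinite)
    {μ : ℕ → Option ℕ →₀ ℝ} (hμ : IsANSeq F μ) :
    ∃ (N a : ℕ → ℕ), Tendsto N atTop atTop ∧ Monotone a ∧
      (∀ k x, a (k + 1) ≤ x → μ (N k) (some x) = 0) ∧
      (∀ k : ℕ, ∑ x ∈ Finset.range (a k), |μ (N k) (some x)| < 1 / ((k : ℝ) + 1)) ∧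
      ∀ k : ℕ, (k : ℝ) < ∑ x ∈ Finset.range (a (k + 1)), |μ (N k) (some x)| := by
  obtain ⟨hnorm, hclopen⟩ := hμ
  have hbound : ∀ n, ∃ b, ∀ x ∉ Finset.range b, μ n (some x) = 0 := fun n => by
    obtain ⟨b, hb⟩ := (Finset.eraseNone (μ n).support).exists_nat_subset_range
    refine ⟨b, fun x hx => ?_⟩
    by_contra h
    exact hx (hb (by simpa using h))
  choose b hb using hbound
  have hatom : ∀ x, Tendsto (fun n => |μ n (some x)|) atTop (nhds 0) := fun x => by
    have h := (hclopen _ (isClopen_image_some (A := {x})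
      (hfree (Set.finite_singleton x).compl_mem_cofinite))).abs
    rw [abs_zero] at h
    refine h.congr fun n => ?_
    have hx : fsMeas (μ n) (some '' {x}) = μ n (some x) := by
      classical
      rw [fsMeas, Set.image_singleton]
      simp [Set.indicator_apply, eq_comm]
    rw [hx]
  have hhead : ∀ c, Tendsto (fun n => ∑ x ∈ Finset.range c, |μ n (some x)|) atTop (nhds 0) :=
    fun c => by simpa using tendsto_finsetSum (Finset.range c) fun x _ => hatom x
  have huniv : Tendsto (fun n => fsMeas (μ n) Set.univ) atTop (nhds 0) :=
    hclopen _ (by rw [isClopen_NFTop_iff]; simp)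
  have htail : ∀ k : ℕ, ∀ᶠ n in atTop, (k : ℝ) < ∑ x ∈ Finset.range (b n), |μ n (some x)| :=
    fun k => by
      filter_upwards [hnorm.eventually_ge_atTop (2 * k + 2),
        huniv.eventually (gt_mem_nhds one_pos), huniv.eventually (lt_mem_nhds neg_one_lt_zero)]
        with n h1 h2 h3
      rw [fsNorm_eq_sum (hb n)] at h1
      rw [fsMeas_eq_sum (hb n)] at h2 h3
      simp only [Set.indicator_univ] at h2 h3
      have h4 := abs_le.1 (Finset.abs_sum_le_sum_abs (fun x => μ n (some x)) (Finset.range (b n)))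
      rcases abs_cases (μ n none) with h5 | h5 <;> linarith [h4.1, h4.2]
  have hstep : ∀ c k : ℕ, ∃ n, k ≤ n ∧
      ∑ x ∈ Finset.range c, |μ n (some x)| < 1 / ((k : ℝ) + 1) ∧
      (k : ℝ) < ∑ x ∈ Finset.range (b n), |μ n (some x)| := fun c k =>
    ((eventually_ge_atTop k).and (((hhead c).eventually
      (gt_mem_nhds Nat.one_div_pos_of_nat)).and (htail k))).exists
  choose N hN hsmall hlarge using hstep
  let a : ℕ → ℕ := fun k => Nat.rec 0 (fun k c => max c (b (N c k))) k
  have ha : ∀ k, a (k + 1) = max (a k) (b (N (a k) k)) := fun _ => rfl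
  refine ⟨fun k => N (a k) k, a, tendsto_atTop_mono (fun k => hN _ k) tendsto_id,
    monotone_nat_of_le_succ fun k => ha k ▸ le_max_left _ _, fun k x hx => hb _ x ?_,
    fun k => hsmall _ k, fun k => (hlarge (a k) k).trans_le ?_⟩
  · rw [ha] at hx
    simpa using le_of_max_le_right hx
  · exact Finset.sum_le_sum_of_subset_of_nonneg
      (Finset.range_mono (ha k ▸ le_max_right _ _)) fun _ _ _ => abs_nonneg _

theorem IsANSeq.exists_density {F : Filter ℕ} (hfree : F ≤ Filter.cofinite)
    {μ : ℕ → Option ℕ →₀ ℝ} (hμ : IsANSeq F μ) :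
    ∃ φ : Submeasure, φ.IsDensity ∧ φ.toFun Set.univ = ⊤ ∧ ∀ A ∈ F, Aᶜ ∈ Exh φ := by
  obtain ⟨N, a, hN, hmono, hsupp, hsmall, hlarge⟩ := hμ.exists_humps hfree
  let m : ℕ → ℕ → ℝ := fun k x => μ (N k) (some x)
  let ν : ℕ → ℕ →₀ ℝ := fun k => Finsupp.onFinset (Finset.Ico (a k) (a (k + 1)))
    ((Set.Ico (a k) (a (k + 1))).indicator fun x => |m k x|) fun x hx => by
      simpa using Set.mem_of_indicator_ne_zero hx
  have hν : ∀ k, ⇑(ν k) = (Set.Ico (a k) (a (k + 1))).indicator fun x => |m k x| :=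
    fun _ => rfl
  have hpos : ∀ k x, 0 ≤ ν k x := fun k x => by
    rw [hν]
    exact Set.indicator_nonneg (fun _ _ => abs_nonneg _) x
  have hν_supp : ∀ k, ∀ x ∈ (ν k).support, a k ≤ x ∧ x < a (k + 1) := fun k x hx => by
    rw [Finsupp.mem_support_iff, hν] at hx
    exact Set.mem_of_indicator_ne_zero (s := Set.Ico (a k) (a (k + 1))) hx
  have huniq : ∀ j k x, a j ≤ x → x < a (j + 1) → a k ≤ x → x < a (k + 1) → j = k := by
    intro j k x h1 h2 h3 h4
    by_contra hjk
    rcases Nat.lt_or_gt_of_ne hjk with h | h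
    · have := hmono (Nat.succ_le_of_lt h)
      simp only [Nat.succ_eq_add_one] at this
      omega
    · have := hmono (Nat.succ_le_of_lt h)
      simp only [Nat.succ_eq_add_one] at this
      omega
  have hdisj : ∀ j k, j ≠ k → Disjoint (ν j).support (ν k).support := fun j k hjk =>
    Finset.disjoint_left.2 fun x hj hk => hjk
      (huniq j k x (hν_supp j x hj).1 (hν_supp j x hj).2 (hν_supp k x hk).1 (hν_supp k x hk).2)
  have hmeas : ∀ k A, natMeas (ν k) A = ∑ x ∈ Finset.range (a (k + 1)), A.indicator (ν k) x :=
    fun k A => natMeas_eq_sum (fun x hx => by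
      rw [hν, Set.indicator_of_notMem]
      exact fun h => hx (Finset.mem_range.2 h.2)) A
  have hone : ∀ k : ℕ, 1 / ((k : ℝ) + 1) ≤ 1 := fun k =>
    (div_le_one (by positivity)).2 (by linarith [k.cast_nonneg (α := ℝ)])
  have hhead : ∀ k, ∑ x ∈ Finset.range (a (k + 1)), (Set.Iio (a k)).indicator (fun x => |m k x|) x
      = ∑ x ∈ Finset.range (a k), |m k x| := fun k => by
    rw [← Finset.sum_subset (Finset.range_mono (hmono k.le_succ))]
    · exact Finset.sum_congr rfl fun x hx =>
        Set.indicator_of_mem (s := Set.Iio (a k)) (Finset.mem_range.1 hx) _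
    · exact fun x _ hx =>
        Set.indicator_of_notMem (s := Set.Iio (a k)) (fun h => hx (Finset.mem_range.2 h)) _
  have hlim : ∀ A ∈ F, Tendsto (fun k => natMeas (ν k) Aᶜ) atTop (nhds 0) := fun A hA => by
    set B : Set ℕ := {x ∈ Aᶜ | ∃ k, a k ≤ x ∧ x < a (k + 1) ∧ 0 ≤ m k x}
    have hclopen : ∀ C ⊆ Aᶜ, Tendsto (fun k => fsMeas (μ (N k)) (some '' C)) atTop (nhds 0) :=
      fun C hC => (hμ.2 _ (isClopen_image_some
        (mem_of_superset hA (Set.subset_compl_comm.1 hC)))).comp hN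
    have hval : ∀ k C, fsMeas (μ (N k)) (some '' C) =
        ∑ x ∈ Finset.range (a (k + 1)), C.indicator (m k) x := fun k C => by
      classical
      rw [fsMeas_eq_sum (s := Finset.range (a (k + 1)))
        fun x hx => hsupp k x (by simpa using hx)]
      simp [Set.indicator_apply, m]
    have hupper := ((hclopen B fun _ h => h.1).sub
      (hclopen (Aᶜ \ B) Set.sdiff_subset)).add tendsto_one_div_add_atTop_nhds_zero_nat
    rw [sub_zero, add_zero] at hupper
    refine squeeze_zero (fun k => natMeas_nonneg (hpos k) _) (fun k => ?_) hupper
    refine le_trans ?_ (add_le_add_right (hsmall k).le _)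
    rw [← hhead, hval, hval, hmeas, ← Finset.sum_sub_distrib, ← Finset.sum_add_distrib]
    refine Finset.sum_le_sum fun x hx => ?_
    rw [Finset.mem_range] at hx
    by_cases hxA : x ∈ Aᶜ
    · rw [Set.indicator_of_mem hxA, hν]
      by_cases hxa : x < a k
      · rw [Set.indicator_of_notMem (s := Set.Ico _ _) fun h => h.1.not_gt hxa,
          Set.indicator_of_mem (s := Set.Iio _) hxa]
        by_cases hxB : x ∈ B
        · rw [Set.indicator_of_mem hxB, Set.indicator_of_notMem fun h => h.2 hxB]
          linarith [neg_abs_le (m k x)]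
        · rw [Set.indicator_of_notMem hxB, Set.indicator_of_mem (s := Aᶜ \ B) ⟨hxA, hxB⟩]
          linarith [le_abs_self (m k x)]
      · rw [Set.indicator_of_mem (s := Set.Ico (a k) (a (k + 1))) ⟨not_lt.1 hxa, hx⟩,
          Set.indicator_of_notMem (s := Set.Iio _) hxa]
        by_cases hxm : 0 ≤ m k x
        · have hxB : x ∈ B := ⟨hxA, k, not_lt.1 hxa, hx, hxm⟩
          rw [Set.indicator_of_mem hxB, Set.indicator_of_notMem fun h => h.2 hxB,
            abs_of_nonneg hxm]
          simp
        · have hxB : x ∉ B := by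
            rintro ⟨-, j, h1, h2, h3⟩
            exact hxm (huniq j k x h1 h2 (not_lt.1 hxa) hx ▸ h3)
          rw [Set.indicator_of_notMem hxB, Set.indicator_of_mem (s := Aᶜ \ B) ⟨hxA, hxB⟩,
            abs_of_neg (not_le.1 hxm)]
          simp
    · rw [Set.indicator_of_notMem hxA, Set.indicator_of_notMem fun h : x ∈ B => hxA h.1,
        Set.indicator_of_notMem fun h : x ∈ Aᶜ \ B => hxA h.1]
      simpa using Set.indicator_nonneg (fun _ _ => abs_nonneg _) x
  refine ⟨densitySubmeasure ν hpos hdisj, ⟨ν, hpos, hdisj, fun _ => rfl⟩, ?_, fun A hA => ?_⟩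
  · refine ENNReal.eq_top_of_forall_nnreal_le fun r => ?_
    obtain ⟨k, hk⟩ := exists_nat_ge ((r : ℝ) + 1)
    refine le_iSup_of_le k ?_
    rw [← ENNReal.ofReal_coe_nnreal]
    refine ENNReal.ofReal_le_ofReal ?_
    have hle : ∑ x ∈ Finset.range (a (k + 1)), |m k x| ≤ natMeas (ν k) Set.univ +
        ∑ x ∈ Finset.range (a k), |m k x| := by
      rw [← hhead, hmeas, ← Finset.sum_add_distrib]
      refine Finset.sum_le_sum fun x hx => ?_
      rw [Finset.mem_range] at hx
      by_cases hxa : x < a k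
      · simp [hν, hxa, hxa.not_ge]
      · simp [hν, hxa, hx, not_lt.1 hxa]
    have h1 := hlarge k
    have h2 := hsmall k
    simp only [m] at hle
    linarith [hone k]
  · refine ENNReal.tendsto_atTop_zero.2 fun ε hε => ?_
    have h0 := (ENNReal.tendsto_ofReal (hlim A hA))
    rw [ENNReal.ofReal_zero] at h0
    obtain ⟨K, hK⟩ := ENNReal.tendsto_atTop_zero.1 h0 ε hε
    refine ⟨a K, fun n hn => iSup_le fun k => ?_⟩
    rcases le_or_gt K k with hk | hk
    · exact (ENNReal.ofReal_le_ofReal (natMeas_mono (hpos k) Set.sdiff_subset)).trans (hK k hk)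
    · have hz : natMeas (ν k) (Aᶜ \ Set.Iic n) = 0 := Finset.sum_eq_zero fun x hx =>
        Set.indicator_of_notMem (fun h => h.2 (((hν_supp k x hx).2.le.trans
          (hmono (Nat.succ_le_of_lt hk))).trans hn)) _
      simp [hz]

/-- Theorem `thm_AN_exh`. For a free filter `F` on `ω` the following are
equivalent: (1) `F` does not have the Nikodym property; (2) there is a density submeasure `φ`
with `φ(ℕ) = ∞` and `F ⊆ Exh(φ)*`; (3) there is a non-pathological lsc submeasure `φ`
with `φ(ℕ) = ∞` and `F ⊆ Exh(φ)*`. -/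
theorem not_nikodym_tfae_exh (F : Filter ℕ)
    (hfree : F ≤ Filter.cofinite) (hne : F.NeBot) :
    List.TFAE
      [ ¬ HasNikodymProp F,
        ∃ φ : Submeasure, φ.IsDensity ∧ φ.toFun Set.univ = ⊤ ∧ ∀ A ∈ F, Aᶜ ∈ Exh φ,
        ∃ φ : Submeasure, φ.LSC ∧ φ.Nonpathological ∧ φ.toFun Set.univ = ⊤ ∧
          ∀ A ∈ F, Aᶜ ∈ Exh φ ] := by
  tfae_have 1 → 2 := fun h => by
    obtain ⟨μ, hμ⟩ := not_not.1 h
    exact hμ.exists_density hfree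
  tfae_have 2 → 3 := fun ⟨φ, hφ, htop, hF⟩ => ⟨φ, hφ.lsc, hφ.nonpathological, htop, hF⟩
  tfae_have 3 → 1 := fun ⟨_, hlsc, hnp, htop, hF⟩ =>
    not_not.2 (exists_anSeq_of_submeasure hlsc hnp htop hF)
  tfae_finish
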